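/- Let the state space have size S ≥ 5, and let d₁, d₂ be positive integers with d₁ ≥ 10 S log(S) · d₂; set γ = 1 − 1/d₂. Then for any transition kernel p, any state s, any non-negative reward function r, and any stationary policy π, the discounted value is dominated by the finite-horizon value: W^π_γ(r, p, 1_s) ≤ 10 · W^π_{d₁}(r, p, 1_s). -/

import Mathlib

open scoped Classical BigOperators

/-- Distribution of the state at step `n+1` (0-indexed `n`), following the stationary policy
`π` under the transition kernel `p`, starting from the initial distribution `μ`. -/
noncomputable def stepDist {S A : Type*} [Fintype S] (p : S → A → S → ℝ) (π : S → A)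
    (μ : S → ℝ) : ℕ → S → ℝ
  | 0, s => μ s
  | n + 1, s' => ∑ s : S, stepDist p π μ n s * p s (π s) s'

/-- Expected reward collected at step `n+1` (0-indexed `n`). -/
noncomputable def expReward {S A : Type*} [Fintype S] (p : S → A → S → ℝ) (r : S → A → ℝ)
    (π : S → A) (μ : S → ℝ) (n : ℕ) : ℝ :=
  ∑ s : S, stepDist p π μ n s * r s (π s)

/-- Finite-horizon value `W_d^π(r, p, μ) = E[Σ_{h=1}^d r(s_h, a_h)]`. -/
noncomputable def Wfin {S A : Type*} [Fintype S] (p : S → A → S → ℝ) (r : S → A → ℝ)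
    (π : S → A) (μ : S → ℝ) (d : ℕ) : ℝ :=
  ∑ n ∈ Finset.range d, expReward p r π μ n

/-- Discounted value `W_γ^π(r, p, μ) = E[Σ_{i=1}^∞ γ^{i-1} r(s_i, a_i)]`. -/
noncomputable def Wdisc {S A : Type*} [Fintype S] (p : S → A → S → ℝ) (r : S → A → ℝ)
    (π : S → A) (μ : S → ℝ) (γ : ℝ) : ℝ :=
  ∑' n : ℕ, γ ^ n * expReward p r π μ n

/-- The Dirac initial distribution at `s`. -/
noncomputable def dirac {S : Type*} (s : S) : S → ℝ := fun s' => if s' = s then 1 else 0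

/-- The part of the matrix `P` supported on rows and columns in `A`. -/
noncomputable def killed {S : Type*} (P : Matrix S S ℝ) (A : Finset S) : Matrix S S ℝ :=
  fun y z => if y ∈ A ∧ z ∈ A then P y z else 0

section Killed

variable {S : Type*} {P : Matrix S S ℝ}

lemma killed_nonneg (hP : ∀ y z, 0 ≤ P y z) (A : Finset S) (y z : S) : 0 ≤ killed P A y z := by
  unfold killed
  split_ifs
  exacts [hP y z, le_rfl]

lemma killed_sum_le_one [Fintype S] (hP : ∀ y z, 0 ≤ P y z) (hP1 : ∀ y, ∑ z, P y z ≤ 1)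
    (A : Finset S) (y : S) : ∑ z, killed P A y z ≤ 1 := by
  refine (Finset.sum_le_sum fun z _ => ?_).trans (hP1 y)
  unfold killed
  split_ifs
  exacts [le_rfl, hP y z]

lemma killed_pow_apply_of_notMem [Fintype S] {A : Finset S} {y x : S} (hy : y ∉ A)
    (hyx : y ≠ x) (n : ℕ) : (killed P A ^ n) y x = 0 := by
  cases n with
  | zero => simp [hyx]
  | succ n => simp [pow_succ', Matrix.mul_apply, killed, hy]

end Killed

section Matrix

variable {S : Type*} [Fintype S] {M : Matrix S S ℝ}

lemma matrix_pow_nonneg (hM : ∀ y z, 0 ≤ M y z) (n : ℕ) (y z : S) : 0 ≤ (M ^ n) y z := by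
  induction n generalizing y with
  | zero => rw [pow_zero, Matrix.one_apply]; split_ifs <;> norm_num
  | succ n ih =>
    rw [pow_succ', Matrix.mul_apply]
    exact Finset.sum_nonneg fun w _ => mul_nonneg (hM y w) (ih w)

lemma matrix_pow_sum_le_one (hM : ∀ y z, 0 ≤ M y z) (hM1 : ∀ y, ∑ z, M y z ≤ 1) (n : ℕ) (y : S) :
    ∑ z, (M ^ n) y z ≤ 1 := by
  induction n generalizing y with
  | zero => simp [Matrix.one_apply]
  | succ n ih =>
    simp_rw [pow_succ', Matrix.mul_apply]
    rw [Finset.sum_comm]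
    simp_rw [← Finset.mul_sum]
    exact (Finset.sum_le_sum fun w _ => mul_le_of_le_one_right (hM y w) (ih w)).trans (hM1 y)

/-- Weighted averages with total mass at most one preserve upper bounds. -/
lemma sum_mul_le_of_le {w f : S → ℝ} {C : ℝ} (hw : ∀ z, 0 ≤ w z) (hw1 : ∑ z, w z ≤ 1)
    (hC : 0 ≤ C) (hf : ∀ z, f z ≤ C) : ∑ z, w z * f z ≤ C :=
  calc ∑ z, w z * f z ≤ ∑ z, w z * C :=
        Finset.sum_le_sum fun z _ => mul_le_mul_of_nonneg_left (hf z) (hw z)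
    _ = (∑ z, w z) * C := by rw [Finset.sum_mul]
    _ ≤ C := mul_le_of_le_one_left hC hw1

/-- The expected number of visits to `x` before time `d` is largest when starting at `x`. -/
lemma visits_le_visits_self (hM : ∀ y z, 0 ≤ M y z) (hM1 : ∀ y, ∑ z, M y z ≤ 1) (x : S) (d : ℕ)
    (y : S) : ∑ n ∈ Finset.range d, (M ^ n) y x ≤ ∑ n ∈ Finset.range d, (M ^ n) x x := by
  induction d generalizing y with
  | zero => simp
  | succ d ih =>
    by_cases hyx : y = x
    · rw [hyx]
    rw [Finset.sum_range_succ', Finset.sum_range_succ (fun n => (M ^ n) x x)]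
    have h0 : (M ^ 0) y x = 0 := by simp [hyx]
    have h1 : ∑ n ∈ Finset.range d, (M ^ (n + 1)) y x
        = ∑ z, M y z * ∑ n ∈ Finset.range d, (M ^ n) z x := by
      simp_rw [pow_succ', Matrix.mul_apply, Finset.mul_sum]
      exact Finset.sum_comm
    have h2 := sum_mul_le_of_le (hM y) (hM1 y)
      (Finset.sum_nonneg fun n _ => matrix_pow_nonneg hM n x x) ih
    have h3 := matrix_pow_nonneg hM d x x
    linarith

/-- Discounted visits to `x` are controlled by the visits to `x` from `x` before time `d`. -/
lemma discounted_visits_le (hM : ∀ y z, 0 ≤ M y z) (hM1 : ∀ y, ∑ z, M y z ≤ 1) {γ : ℝ}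
    (hγ : 0 ≤ γ) (hγ1 : γ ≤ 1) {d : ℕ} (hd : 1 ≤ d) (hγd : γ ^ d < 1) (x y : S) (N : ℕ) :
    ∑ n ∈ Finset.range N, γ ^ n * (M ^ n) y x
      ≤ (1 - γ ^ d)⁻¹ * ∑ n ∈ Finset.range d, (M ^ n) x x := by
  set u := ∑ n ∈ Finset.range d, (M ^ n) x x
  have hu0 : 0 ≤ u := Finset.sum_nonneg fun n _ => matrix_pow_nonneg hM n x x
  have hpos : 0 < 1 - γ ^ d := by linarith
  have hC : 0 ≤ (1 - γ ^ d)⁻¹ * u := by positivity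
  have key : ∀ (k : ℕ) (y : S), ∑ n ∈ Finset.range (d * k), γ ^ n * (M ^ n) y x
      ≤ (1 - γ ^ d)⁻¹ * u := by
    intro k
    induction k with
    | zero => intro y; simpa using hC
    | succ k ih =>
      intro y
      rw [Nat.mul_succ, add_comm, Finset.sum_range_add]
      have h1 : ∑ n ∈ Finset.range d, γ ^ n * (M ^ n) y x ≤ u := by
        refine (Finset.sum_le_sum fun n _ => ?_).trans (visits_le_visits_self hM hM1 x d y)
        exact mul_le_of_le_one_left (matrix_pow_nonneg hM n y x) (pow_le_one₀ hγ hγ1)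
      have h2 : ∑ n ∈ Finset.range (d * k), γ ^ (d + n) * (M ^ (d + n)) y x
          = γ ^ d * ∑ z, (M ^ d) y z * ∑ n ∈ Finset.range (d * k), γ ^ n * (M ^ n) z x := by
        simp_rw [pow_add, Matrix.mul_apply, Finset.mul_sum]
        rw [Finset.sum_comm]
        refine Finset.sum_congr rfl fun z _ => Finset.sum_congr rfl fun n _ => ?_
        ring
      have h3 := sum_mul_le_of_le (matrix_pow_nonneg hM d y) (matrix_pow_sum_le_one hM hM1 d y)
        hC ih
      have h4 := mul_le_mul_of_nonneg_left h3 (pow_nonneg hγ d)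
      have h5 : u + γ ^ d * ((1 - γ ^ d)⁻¹ * u) = (1 - γ ^ d)⁻¹ * u := by
        field_simp
        ring
      linarith
  refine (Finset.sum_le_sum_of_subset_of_nonneg ?_ fun n _ _ => ?_).trans (key N y)
  · exact Finset.range_mono (Nat.le_mul_of_pos_left N hd)
  · exact mul_nonneg (pow_nonneg hγ n) (matrix_pow_nonneg hM n y x)

end Matrix

lemma pow_eq_pow_add_sum {R : Type*} [Ring R] (a b : R) (n : ℕ) :
    a ^ n = b ^ n + ∑ i ∈ Finset.range n, a ^ i * ((a - b) * b ^ (n - 1 - i)) := by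
  induction n with
  | zero => simp
  | succ n ih =>
    rw [Finset.sum_range_succ']
    have h : ∑ i ∈ Finset.range n, a ^ (i + 1) * ((a - b) * b ^ (n + 1 - 1 - (i + 1)))
        = a * ∑ i ∈ Finset.range n, a ^ i * ((a - b) * b ^ (n - 1 - i)) := by
      rw [Finset.mul_sum]
      refine Finset.sum_congr rfl fun i _ => ?_
      rw [show n + 1 - 1 - (i + 1) = n - 1 - i by omega, pow_succ', mul_assoc]
    rw [h, pow_succ' a, pow_succ' b]
    nth_rewrite 1 [ih]
    simp only [pow_zero, one_mul, Nat.add_sub_cancel, Nat.sub_zero]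
    noncomm_ring

/-- Last-exit decomposition at `s` of the paths from `s` to `x ≠ s` inside `A`. -/
lemma killed_pow_succ_eq_sum {S : Type*} [Fintype S] (P : Matrix S S ℝ) (A : Finset S) {s x : S}
    (hsx : s ≠ x) (n : ℕ) :
    (killed P A ^ (n + 1)) s x = ∑ i ∈ Finset.range (n + 1), (killed P A ^ i) s s *
      ∑ y, killed P A s y * (killed P (A.erase s) ^ (n - i)) y x := by
  have hs : s ∉ A.erase s := Finset.notMem_erase s A
  rw [pow_eq_pow_add_sum (killed P A) (killed P (A.erase s)), Matrix.add_apply,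
    killed_pow_apply_of_notMem hs hsx, zero_add, Matrix.sum_apply]
  refine Finset.sum_congr rfl fun i _ => ?_
  rw [Matrix.mul_apply, Finset.sum_eq_single s]
  · rw [Matrix.mul_apply]
    congr 1
    refine Finset.sum_congr rfl fun y _ => ?_
    simp [killed]
  · intro z _ hz
    rw [Matrix.mul_apply, Finset.sum_eq_zero, mul_zero]
    intro y _
    by_cases hy : y = s
    · rw [hy, killed_pow_apply_of_notMem hs hsx, mul_zero]
    · simp [killed, hz, hy]
  · simp

/-- Partial sums of a convolution are at most the product of the partial sums. -/
lemma sum_conv_le {a b : ℕ → ℝ} (ha : ∀ i, 0 ≤ a i) (hb : ∀ i, 0 ≤ b i) (N : ℕ) :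
    ∑ n ∈ Finset.range N, ∑ i ∈ Finset.range (n + 1), a i * b (n - i)
      ≤ (∑ i ∈ Finset.range N, a i) * ∑ j ∈ Finset.range N, b j := by
  rw [Finset.sum_range_diag_flip N fun i j => a i * b j, Finset.sum_mul]
  refine Finset.sum_le_sum fun i _ => ?_
  rw [← Finset.mul_sum]
  exact mul_le_mul_of_nonneg_left (Finset.sum_le_sum_of_subset_of_nonneg
    (Finset.range_mono (Nat.sub_le N i)) fun j _ _ => hb j) (ha i)

/-- A product of partial sums is at most a longer partial sum of the convolution. -/
lemma le_sum_conv {a b : ℕ → ℝ} (ha : ∀ i, 0 ≤ a i) (hb : ∀ i, 0 ≤ b i) {d m N : ℕ}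
    (h : d + m ≤ N + 1) :
    (∑ i ∈ Finset.range d, a i) * ∑ j ∈ Finset.range m, b j
      ≤ ∑ n ∈ Finset.range N, ∑ i ∈ Finset.range (n + 1), a i * b (n - i) := by
  rcases Nat.eq_zero_or_pos m with rfl | hm
  · simpa using Finset.sum_nonneg fun n _ => Finset.sum_nonneg fun i _ =>
      mul_nonneg (ha i) (hb (n - i))
  rw [Finset.sum_range_diag_flip N fun i j => a i * b j, Finset.sum_mul]
  simp_rw [← Finset.mul_sum]
  refine (Finset.sum_le_sum fun i hi => ?_).trans
    (Finset.sum_le_sum_of_subset_of_nonneg (Finset.range_mono (show d ≤ N by omega))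
      fun i _ _ => mul_nonneg (ha i) (Finset.sum_nonneg fun j _ => hb j))
  have hi' := Finset.mem_range.1 hi
  exact mul_le_mul_of_nonneg_left (Finset.sum_le_sum_of_subset_of_nonneg
    (Finset.range_mono (show m ≤ N - i by omega)) fun j _ _ => hb j) (ha i)

/-- Within `A`, discounted visits are bounded by visits before time `#A * d`, at the price of a
factor `(1 - γ ^ d)⁻¹` for each state of `A`. -/
lemma killed_discounted_visits_le {S : Type*} [Fintype S] {P : Matrix S S ℝ}
    (hP : ∀ y z, 0 ≤ P y z) (hP1 : ∀ y, ∑ z, P y z ≤ 1) {γ : ℝ}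
    (hγ : 0 ≤ γ) (hγ1 : γ ≤ 1) {d : ℕ} (hd : 1 ≤ d) (hγd : γ ^ d < 1) (N : ℕ) (A : Finset S)
    {x : S} (hx : x ∈ A) (s : S) :
    ∑ n ∈ Finset.range N, γ ^ n * (killed P A ^ n) s x
      ≤ (1 - γ ^ d)⁻¹ ^ A.card * ∑ n ∈ Finset.range (A.card * d), (killed P A ^ n) s x := by
  induction hk : A.card generalizing A s with
  | zero => simp [Finset.card_eq_zero.1 hk] at hx
  | succ k ih =>
  have hAn := fun n => matrix_pow_nonneg (killed_nonneg hP A) n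
  have hc1 : 1 ≤ (1 - γ ^ d)⁻¹ :=
    (one_le_inv₀ (by linarith)).2 (by linarith [pow_nonneg hγ d])
  have hc0 : 0 ≤ (1 - γ ^ d)⁻¹ := by linarith
  set c := (1 - γ ^ d)⁻¹
  have hdisc := discounted_visits_le (killed_nonneg hP A) (killed_sum_le_one hP hP1 A)
    hγ hγ1 hd hγd
  by_cases hsx : s = x
  · subst hsx
    refine (hdisc s s N).trans ?_
    have h0 : 0 ≤ ∑ n ∈ Finset.range d, (killed P A ^ n) s s :=
      Finset.sum_nonneg fun n _ => hAn n s s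
    refine mul_le_mul (le_self_pow₀ hc1 k.succ_ne_zero) ?_ h0 (by positivity)
    exact Finset.sum_le_sum_of_subset_of_nonneg
      (Finset.range_mono (Nat.le_mul_of_pos_left d k.succ_pos)) fun n _ _ => hAn n s s
  have hrhs : ∀ m, 0 ≤ ∑ n ∈ Finset.range m, (killed P A ^ n) s x := fun m =>
    Finset.sum_nonneg fun n _ => hAn n s x
  by_cases hs : s ∉ A
  · rw [Finset.sum_eq_zero]
    · exact mul_nonneg (by positivity) (hrhs _)
    · intro n _
      rw [killed_pow_apply_of_notMem hs hsx, mul_zero]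
  push Not at hs
  have hcard : (A.erase s).card = k := by rw [Finset.card_erase_of_mem hs, hk]; rfl
  have hBn := fun n => matrix_pow_nonneg (killed_nonneg hP (A.erase s)) n
  set a : ℕ → ℝ := fun i => (killed P A ^ i) s s
  set b : ℕ → ℝ := fun j => ∑ y, killed P A s y * (killed P (A.erase s) ^ j) y x with hb
  have ha0 : ∀ i, 0 ≤ a i := fun i => hAn i s s
  have hb0 : ∀ j, 0 ≤ b j := fun j =>
    Finset.sum_nonneg fun y _ => mul_nonneg (killed_nonneg hP A s y) (hBn j y x)
  have hdec : ∀ n, (killed P A ^ (n + 1)) s x = ∑ i ∈ Finset.range (n + 1), a i * b (n - i) :=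
    killed_pow_succ_eq_sum P A hsx
  have hzero : (killed P A ^ 0) s x = 0 := by simp [hsx]
  have hb_le : ∑ j ∈ Finset.range N, γ ^ j * b j ≤ c ^ k * ∑ j ∈ Finset.range (k * d), b j := by
    have e1 : ∑ j ∈ Finset.range N, γ ^ j * b j = ∑ y, killed P A s y *
        ∑ j ∈ Finset.range N, γ ^ j * (killed P (A.erase s) ^ j) y x := by
      simp_rw [hb, Finset.mul_sum]
      rw [Finset.sum_comm]
      refine Finset.sum_congr rfl fun y _ => Finset.sum_congr rfl fun j _ => ?_
      ring
    have e2 : c ^ k * ∑ j ∈ Finset.range (k * d), b j = ∑ y, killed P A s y *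
        (c ^ k * ∑ j ∈ Finset.range (k * d), (killed P (A.erase s) ^ j) y x) := by
      simp_rw [hb, Finset.mul_sum]
      rw [Finset.sum_comm]
      refine Finset.sum_congr rfl fun y _ => Finset.sum_congr rfl fun j _ => ?_
      ring
    rw [e1, e2]
    exact Finset.sum_le_sum fun y _ => mul_le_mul_of_nonneg_left
      (ih (A.erase s) (Finset.mem_erase.2 ⟨Ne.symm hsx, hx⟩) y hcard) (killed_nonneg hP A s y)
  have hγa : ∀ i, 0 ≤ γ ^ i * a i := fun i => mul_nonneg (pow_nonneg hγ i) (ha0 i)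
  have hγb : ∀ i, 0 ≤ γ ^ i * b i := fun i => mul_nonneg (pow_nonneg hγ i) (hb0 i)
  have hupper : ∑ n ∈ Finset.range N, γ ^ n * (killed P A ^ n) s x ≤
      (∑ i ∈ Finset.range N, γ ^ i * a i) * ∑ j ∈ Finset.range N, γ ^ j * b j := by
    refine le_trans ?_ (sum_conv_le hγa hγb N)
    refine (Finset.sum_le_sum_of_subset_of_nonneg (Finset.range_mono N.le_succ)
      fun n _ _ => mul_nonneg (pow_nonneg hγ n) (hAn n s x)).trans ?_
    rw [Finset.sum_range_succ', hzero, mul_zero, add_zero]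
    refine Finset.sum_le_sum fun n _ => ?_
    rw [hdec, Finset.mul_sum]
    refine Finset.sum_le_sum fun i hi => ?_
    have hi' : i ≤ n := Nat.lt_succ_iff.1 (Finset.mem_range.1 hi)
    have e : γ ^ i * a i * (γ ^ (n - i) * b (n - i)) = γ ^ n * (a i * b (n - i)) := by
      rw [← pow_mul_pow_sub γ hi']
      ring
    rw [e]
    exact mul_le_mul_of_nonneg_right (pow_le_pow_of_le_one hγ hγ1 n.le_succ)
      (mul_nonneg (ha0 _) (hb0 _))
  have hlower : (∑ i ∈ Finset.range d, a i) * ∑ j ∈ Finset.range (k * d), b j ≤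
      ∑ n ∈ Finset.range ((k + 1) * d), (killed P A ^ n) s x := by
    obtain ⟨m, hm⟩ : ∃ m, (k + 1) * d = m + 1 :=
      Nat.exists_eq_succ_of_ne_zero (Nat.mul_ne_zero k.succ_ne_zero (by omega))
    rw [hm, Finset.sum_range_succ', hzero, add_zero]
    simp_rw [hdec]
    refine le_sum_conv ha0 hb0 ?_
    rw [← hm]
    exact le_of_eq (by ring)
  calc _ ≤ _ := hupper
    _ ≤ (c * ∑ i ∈ Finset.range d, a i) * (c ^ k * ∑ j ∈ Finset.range (k * d), b j) :=
        mul_le_mul (hdisc s s N) hb_le (Finset.sum_nonneg fun j _ => hγb j)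
          (mul_nonneg hc0 (Finset.sum_nonneg fun i _ => ha0 i))
    _ = c ^ (k + 1) * ((∑ i ∈ Finset.range d, a i) * ∑ j ∈ Finset.range (k * d), b j) := by ring
    _ ≤ _ := mul_le_mul_of_nonneg_left hlower (by positivity)

lemma stepDist_dirac_eq_pow {S A : Type*} [Fintype S] (p : S → A → S → ℝ) (π : S → A) (s : S)
    (n : ℕ) (x : S) :
    stepDist p π (dirac s) n x = (Matrix.of (fun y z => p y (π y) z) ^ n) s x := by
  induction n generalizing x with
  | zero => simp [stepDist, dirac, Matrix.one_apply, eq_comm]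
  | succ n ih => simp only [stepDist, ih, pow_succ, Matrix.mul_apply, Matrix.of_apply]

/-- With `d = d₁ / S`, the loss `(1 - γ ^ d)⁻¹ ^ S` is at most `10`. -/
lemma discount_loss_le {S d₁ d₂ : ℕ} (hS : 5 ≤ S) (hd₂ : 1 ≤ d₂)
    (hgap : 10 * (S : ℝ) * Real.log S * (d₂ : ℝ) ≤ (d₁ : ℝ)) :
    1 ≤ d₁ / S ∧ (1 - 1 / (d₂ : ℝ)) ^ (d₁ / S) < 1 ∧
      (1 - (1 - 1 / (d₂ : ℝ)) ^ (d₁ / S))⁻¹ ^ S ≤ 10 := by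
  have hS' : (5 : ℝ) ≤ S := by exact_mod_cast hS
  have hd₂' : (1 : ℝ) ≤ d₂ := by exact_mod_cast hd₂
  have hlog : 1 ≤ Real.log S := by
    rw [Real.le_log_iff_exp_le (by linarith)]
    linarith [Real.exp_one_lt_d9]
  have hγ : 0 ≤ 1 - 1 / (d₂ : ℝ) := by
    rw [sub_nonneg, div_le_one (by linarith)]
    exact hd₂'
  set d := d₁ / S
  have hdlt : (d₁ : ℝ) < S * (d + 1) := by
    exact_mod_cast Nat.lt_mul_div_succ d₁ (show 0 < S by omega)
  have hd_ge : 10 * Real.log S * d₂ < d + 1 := by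
    have : (S : ℝ) * (10 * Real.log S * d₂) < S * (d + 1) := by linarith
    exact lt_of_mul_lt_mul_left this (by linarith)
  have hd_ge2 : 2 * Real.log S * d₂ ≤ d := by nlinarith
  have hd1 : 1 ≤ d := by
    have : (0 : ℝ) < d := by nlinarith
    exact_mod_cast this
  have hpow : (1 - 1 / (d₂ : ℝ)) ^ d ≤ ((S : ℝ) ^ 2)⁻¹ := by
    calc (1 - 1 / (d₂ : ℝ)) ^ d ≤ Real.exp (-(1 / (d₂ : ℝ))) ^ d :=
          pow_le_pow_left₀ hγ (Real.one_sub_le_exp_neg _) d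
      _ = Real.exp (-(d / d₂)) := by rw [← Real.exp_nat_mul]; congr 1; ring
      _ ≤ Real.exp (-(2 * Real.log S)) := by
          rw [Real.exp_le_exp, neg_le_neg_iff, le_div_iff₀ (by linarith)]
          exact hd_ge2
      _ = ((S : ℝ) ^ 2)⁻¹ := by
          rw [Real.exp_neg, two_mul, Real.exp_add, Real.exp_log (by linarith), sq]
  set q := (1 - 1 / (d₂ : ℝ)) ^ d
  have hq0 : 0 ≤ q := pow_nonneg hγ d
  have hSq : (S : ℝ) * q ≤ 1 / 5 := by
    calc (S : ℝ) * q ≤ S * ((S : ℝ) ^ 2)⁻¹ := mul_le_mul_of_nonneg_left hpow (by linarith)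
      _ = 1 / S := by field_simp
      _ ≤ 1 / 5 := one_div_le_one_div_of_le (by norm_num) hS'
  have hq1 : q < 1 := by nlinarith
  refine ⟨hd1, hq1, ?_⟩
  have hbern := one_add_mul_le_pow (show (-2 : ℝ) ≤ -q by linarith) S
  have hbern' : 1 / 10 ≤ (1 - q) ^ S := by
    rw [sub_eq_add_neg]
    linarith
  rw [inv_pow]
  exact inv_le_of_inv_le₀ (by norm_num) (by linarith)

/-- If the state space has size `S ≥ 5` and `d₁ ≥ 10·S·log S·d₂` with `γ = 1 - 1/d₂`, then
for any transition kernel, state, non-negative reward and stationary policy, the discounted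
value is at most `10` times the horizon-`d₁` value: `W_γ^π(r,p,1_s) ≤ 10·W_{d₁}^π(r,p,1_s)`. -/
theorem discounted_le_finite_horizon {S A : Type*} [Fintype S] [Fintype A]
    (hS : 5 ≤ Fintype.card S)
    (p : S → A → S → ℝ)
    (hp0 : ∀ s a s', 0 ≤ p s a s') (hp1 : ∀ s a, ∑ s' : S, p s a s' = 1)
    (s : S) (π : S → A) (r : S → A → ℝ) (hr : ∀ s' a', 0 ≤ r s' a')
    (d₁ d₂ : ℕ) (hd₁ : 1 ≤ d₁) (hd₂ : 1 ≤ d₂)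
    (hgap : 10 * (Fintype.card S : ℝ) * Real.log (Fintype.card S) * (d₂ : ℝ) ≤ (d₁ : ℝ)) :
    Wdisc p r π (dirac s) (1 - 1 / (d₂ : ℝ)) ≤ 10 * Wfin p r π (dirac s) d₁ := by
  obtain ⟨hd, hγd, hloss⟩ := discount_loss_le hS hd₂ hgap
  have hγ : 0 ≤ 1 - 1 / (d₂ : ℝ) := by
    rw [sub_nonneg, div_le_one (by positivity)]
    exact_mod_cast hd₂
  have hγ1 : 1 - 1 / (d₂ : ℝ) ≤ 1 := sub_le_self 1 (by positivity)
  set γ := 1 - 1 / (d₂ : ℝ)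
  set d := d₁ / Fintype.card S
  set P : Matrix S S ℝ := Matrix.of fun y z => p y (π y) z
  have hP : ∀ y z, 0 ≤ P y z := fun y z => hp0 y (π y) z
  have hstep : ∀ n x, stepDist p π (dirac s) n x = (P ^ n) s x := stepDist_dirac_eq_pow p π s
  have huniv : killed P Finset.univ = P := by
    ext y z
    simp [killed]
  have hvisits : ∀ N x, ∑ n ∈ Finset.range N, γ ^ n * (P ^ n) s x
      ≤ 10 * ∑ n ∈ Finset.range d₁, (P ^ n) s x := by
    intro N x
    have h := killed_discounted_visits_le hP (fun y => (hp1 y (π y)).le) hγ hγ1 hd hγd N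
      Finset.univ (Finset.mem_univ x) s
    rw [huniv, Finset.card_univ] at h
    refine h.trans (mul_le_mul hloss ?_ ?_ (by norm_num))
    · exact Finset.sum_le_sum_of_subset_of_nonneg
        (Finset.range_mono (Nat.mul_div_le d₁ (Fintype.card S)))
        fun n _ _ => matrix_pow_nonneg hP n s x
    · exact Finset.sum_nonneg fun n _ => matrix_pow_nonneg hP n s x
  unfold Wdisc Wfin expReward
  simp_rw [hstep]
  refine Real.tsum_le_of_sum_range_le (fun n => mul_nonneg (pow_nonneg hγ n)
    (Finset.sum_nonneg fun x _ => mul_nonneg (matrix_pow_nonneg hP n s x) (hr x _))) fun N => ?_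
  have e1 : ∑ n ∈ Finset.range N, γ ^ n * ∑ x, (P ^ n) s x * r x (π x)
      = ∑ x, (∑ n ∈ Finset.range N, γ ^ n * (P ^ n) s x) * r x (π x) := by
    simp_rw [Finset.mul_sum, Finset.sum_mul, mul_assoc]
    exact Finset.sum_comm
  have e2 : 10 * ∑ n ∈ Finset.range d₁, ∑ x, (P ^ n) s x * r x (π x)
      = ∑ x, (10 * ∑ n ∈ Finset.range d₁, (P ^ n) s x) * r x (π x) := by
    simp_rw [Finset.mul_sum, Finset.sum_mul, mul_assoc]
    exact Finset.sum_comm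
  rw [e1, e2]
  exact Finset.sum_le_sum fun x _ => mul_le_mul_of_nonneg_right (hvisits N x) (hr x _)
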